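/- arXiv:1509.05125 — 2 statements merged into one kernel-verified Lean document; each statement's English description precedes it below -/
import Mathlib

section
/- Let g : ℝᵐ → ℝ be convex differentiable with block-Lipschitz gradient: for each coordinate block i, ‖∇ᵢg(λ + Pᵢh) − ∇ᵢg(λ)‖ ≤ Lᵢ‖hᵢ‖. Let λ* be the unique minimizer of g over a product of closed convex sets Λ = Λ₁×⋯×Λ_q. Consider random block coordinate descent with fixed scaling Sᵢ ⪯ Lᵢ⁻¹I, unit steps, drawing block iᵏ ∼ π with all πᵢ > 0. With V := (q·diag(π₁S₁,…,π_qS_q))⁻¹, π_min := minᵢ πᵢ, and Ψ(λ) := (q·π_min/2)‖λ − λ*‖_V² + g(λ) − g(λ*), the iterates satisfy E[g(λᵏ) − g(λ*)] ≤ Ψ(λ⁰)/(1 + π_min k) for all k ≥ 0. -/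
open scoped RealInnerProductSpace
open Filter

/-- nonnegativity at first order from a right-sided minimum. -/
lemma aux_deriv_nonneg {φ : ℝ → ℝ} {D : ℝ} (h : HasDerivAt φ D 0) (h0 : φ 0 = 0)
    (hpos : ∀ t, 0 < t → t ≤ 1 → 0 ≤ φ t) : 0 ≤ D := by
  have h1 := h.hasDerivWithinAt (s := Set.Ioi 0)
  rw [hasDerivWithinAt_iff_tendsto_slope' (by simp)] at h1
  refine ge_of_tendsto h1 ?_
  have : Set.Ioc (0 : ℝ) 1 ∈ nhdsWithin (0 : ℝ) (Set.Ioi 0) := Ioc_mem_nhdsGT one_pos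
  filter_upwards [this] with t ht
  rw [slope_def_field, h0]
  have := hpos t ht.1 ht.2
  have := ht.1
  rw [sub_zero, sub_zero]
  positivity

lemma aux_threepoint {E : Type*} [NormedAddCommGroup E] [InnerProductSpace ℝ E]
    (J : E →ₗ[ℝ] E) (hsym : ∀ u v, ⟪J u, v⟫ = ⟪u, J v⟫) {s : Set E} (hs : Convex ℝ s)
    (x y z c : E) (hy : y ∈ s) (hz : z ∈ s)
    (hmin : IsMinOn (fun t => ⟪c, t - x⟫ + (1 / 2) * ⟪t - x, J (t - x)⟫) s y) :
    ⟪y - z, J (y - z)⟫ - ⟪x - z, J (x - z)⟫ ≤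
      2 * ⟪c, z - x⟫ - 2 * (⟪c, y - x⟫ + (1 / 2) * ⟪y - x, J (y - x)⟫) := by
  have key : 0 ≤ ⟪c, z - y⟫ + ⟪z - y, J (y - x)⟫ := by
    have hd : HasDerivAt (fun t : ℝ => t * (⟪c, z - y⟫ + ⟪z - y, J (y - x)⟫)
        + t ^ 2 * ((1 / 2) * ⟪z - y, J (z - y)⟫))
        (⟪c, z - y⟫ + ⟪z - y, J (y - x)⟫) 0 := by
      have h1 := (hasDerivAt_id (0 : ℝ)).mul_const (⟪c, z - y⟫ + ⟪z - y, J (y - x)⟫)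
      have h2 := ((hasDerivAt_id (0 : ℝ)).pow 2).mul_const ((1 / 2) * ⟪z - y, J (z - y)⟫)
      have h3 := h1.add h2
      simp only [id] at h3
      refine (h3.congr_deriv (by simp))
    refine aux_deriv_nonneg hd (by simp) ?_
    intro t ht ht1
    have hm : y + t • (z - y) ∈ s := hs.add_smul_sub_mem hy hz ⟨ht.le, ht1⟩
    have h := hmin hm
    simp only [Set.mem_setOf_eq] at h
    have e : y + t • (z - y) - x = (y - x) + t • (z - y) := by abel
    rw [e] at h
    simp only [map_add, map_smul, inner_add_left, inner_add_right, inner_smul_left,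
      inner_smul_right, RCLike.conj_to_real] at h
    have hh : ⟪y - x, J (z - y)⟫ = ⟪z - y, J (y - x)⟫ := by
      rw [← hsym, real_inner_comm]
    rw [hh] at h
    nlinarith [h]
  have hh : ⟪y - x, J (z - y)⟫ = ⟪z - y, J (y - x)⟫ := by
    rw [← hsym, real_inner_comm]
  have e1 : x - z = -((y - x) + (z - y)) := by abel
  have e2 : y - z = -(z - y) := by abel
  have e3 : z - x = (y - x) + (z - y) := by abel
  rw [e1, e2, e3]
  simp only [map_neg, map_add, inner_neg_left, inner_neg_right, inner_add_left, inner_add_right]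
  rw [hh]
  linarith

lemma aux_matrix {n : ℕ} (S : Matrix (Fin n) (Fin n) ℝ) (L : ℝ) (hL : 0 < L) (hS : S.PosDef)
    (hle : (L⁻¹ • (1 : Matrix (Fin n) (Fin n) ℝ) - S).PosSemidef) :
    (∀ u v, ⟪Matrix.toEuclideanLin S⁻¹ u, v⟫ = ⟪u, Matrix.toEuclideanLin S⁻¹ v⟫) ∧
    (∀ h, L * ‖h‖ ^ 2 ≤ ⟪h, Matrix.toEuclideanLin S⁻¹ h⟫) := by
  have symm : ∀ A : Matrix (Fin n) (Fin n) ℝ, A.IsHermitian →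
      ∀ u v, ⟪Matrix.toEuclideanLin A u, v⟫ = ⟪u, Matrix.toEuclideanLin A v⟫ := by
    intro A hA
    exact (Matrix.isSymmetric_toEuclideanLin_iff.mpr hA)
  have psd : ∀ A : Matrix (Fin n) (Fin n) ℝ, A.PosSemidef →
      ∀ u, 0 ≤ ⟪u, Matrix.toEuclideanLin A u⟫ := by
    intro A hA u
    have := (Matrix.isPositive_toEuclideanLin_iff.mpr hA).2 u
    rw [real_inner_comm]
    simpa using this
  refine ⟨symm _ hS.inv.isHermitian, ?_⟩
  intro h
  set w := Matrix.toEuclideanLin S⁻¹ h with hw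
  have hTw : Matrix.toEuclideanLin S w = h := by
    rw [hw]
    have hu : IsUnit S.det := (Matrix.isUnit_iff_isUnit_det S).mp hS.isUnit
    simp [Matrix.toLpLin_apply, Matrix.mulVec_mulVec, Matrix.mul_nonsing_inv S hu]
  have h1 := psd S hS.posSemidef (w - L • h)
  have h2 := psd _ hle h
  have e2 : Matrix.toEuclideanLin (L⁻¹ • (1 : Matrix (Fin n) (Fin n) ℝ) - S) h
      = L⁻¹ • h - Matrix.toEuclideanLin S h := by
    simp [Matrix.toLpLin_apply, Matrix.sub_mulVec, Matrix.smul_mulVec]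
  rw [e2, inner_sub_right, inner_smul_right, real_inner_self_eq_norm_sq] at h2
  have h3 : ⟪w, Matrix.toEuclideanLin S h⟫ = ‖h‖ ^ 2 := by
    rw [← symm S hS.isHermitian, hTw, real_inner_self_eq_norm_sq]
  simp only [map_sub, map_smul, inner_sub_left, inner_sub_right, inner_smul_left,
      inner_smul_right, RCLike.conj_to_real, hTw, h3, real_inner_self_eq_norm_sq] at h1
  rw [real_inner_comm] at h1
  have h4 : L ^ 2 * (L⁻¹ * ‖h‖ ^ 2) = L * ‖h‖ ^ 2 := by field_simp
  have h5 := mul_nonneg (sq_nonneg L) h2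
  nlinarith

lemma aux_linederiv {nb : ℕ} {d : Fin nb → ℕ}
    {g : ((i : Fin nb) → EuclideanSpace ℝ (Fin (d i))) → ℝ}
    {g' : ((i : Fin nb) → EuclideanSpace ℝ (Fin (d i))) →
      (i : Fin nb) → EuclideanSpace ℝ (Fin (d i))}
    (hg : ∀ lam i, HasGradientAt (fun t => g (Function.update lam i t)) (g' lam i) (lam i))
    (x : (i : Fin nb) → EuclideanSpace ℝ (Fin (d i))) (i : Fin nb)
    (v : EuclideanSpace ℝ (Fin (d i))) (t : ℝ) :
    HasDerivAt (fun s : ℝ => g (Function.update x i (x i + s • v)))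
      ⟪g' (Function.update x i (x i + t • v)) i, v⟫ t := by
  have h := (hg (Function.update x i (x i + t • v)) i).hasFDerivAt
  simp only [Function.update_idem, Function.update_self] at h
  have hl : HasDerivAt (fun s : ℝ => x i + s • v) v t := by
    simpa using ((hasDerivAt_id t).smul_const v).const_add (x i)
  have h2 := h.comp_hasDerivAt t hl
  rw [InnerProductSpace.toDual_apply_apply] at h2
  exact h2

lemma aux_descent {nb : ℕ} {d : Fin nb → ℕ}
    {g : ((i : Fin nb) → EuclideanSpace ℝ (Fin (d i))) → ℝ}
    {g' : ((i : Fin nb) → EuclideanSpace ℝ (Fin (d i))) →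
      (i : Fin nb) → EuclideanSpace ℝ (Fin (d i))}
    (hg : ∀ lam i, HasGradientAt (fun t => g (Function.update lam i t)) (g' lam i) (lam i))
    (Lip : Fin nb → ℝ)
    (hlip : ∀ lam i t,
      ‖g' (Function.update lam i t) i - g' lam i‖ ≤ Lip i * ‖t - lam i‖)
    (x : (i : Fin nb) → EuclideanSpace ℝ (Fin (d i))) (i : Fin nb)
    (y : EuclideanSpace ℝ (Fin (d i))) :
    g (Function.update x i y) - g x ≤ ⟪g' x i, y - x i⟫ + (1 / 2) * (Lip i * ‖y - x i‖ ^ 2) := by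
  set v := y - x i with hv
  have hd : ∀ t : ℝ, HasDerivAt (fun s : ℝ => g (Function.update x i (x i + s • v))
      - (s * ⟪g' x i, v⟫ + s ^ 2 * ((1 / 2) * (Lip i * ‖v‖ ^ 2))))
      (⟪g' (Function.update x i (x i + t • v)) i, v⟫ -
        (⟪g' x i, v⟫ + t * (Lip i * ‖v‖ ^ 2))) t := by
    intro t
    have h1 := (hasDerivAt_id t).mul_const ⟪g' x i, v⟫
    have h2 := ((hasDerivAt_id t).pow 2).mul_const ((1 / 2) * (Lip i * ‖v‖ ^ 2))
    refine ((aux_linederiv hg x i v t).sub (h1.add h2)).congr_deriv ?_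
    simp
    ring
  have hanti := antitoneOn_of_deriv_nonpos (convex_Icc (0 : ℝ) 1)
    (fun t _ => (hd t).continuousAt.continuousWithinAt)
    (fun t _ => (hd t).differentiableAt.differentiableWithinAt)
    (by
      intro t ht
      rw [interior_Icc] at ht
      rw [(hd t).deriv]
      have h1 := hlip x i (x i + t • v)
      rw [add_sub_cancel_left, norm_smul, Real.norm_eq_abs, abs_of_pos ht.1] at h1
      have h2 := real_inner_le_norm (g' (Function.update x i (x i + t • v)) i - g' x i) v
      rw [inner_sub_left] at h2
      nlinarith [norm_nonneg v, mul_le_mul_of_nonneg_right h1 (norm_nonneg v)])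
  have h := hanti (Set.left_mem_Icc.mpr zero_le_one) (Set.right_mem_Icc.mpr zero_le_one)
    zero_le_one
  have e : x i + v = y := by rw [hv]; abel
  simp [e] at h
  linarith

lemma aux_convex {nb : ℕ} (hnb : 0 < nb) {d : Fin nb → ℕ}
    {g : ((i : Fin nb) → EuclideanSpace ℝ (Fin (d i))) → ℝ}
    (hgcv : ConvexOn ℝ Set.univ g)
    {g' : ((i : Fin nb) → EuclideanSpace ℝ (Fin (d i))) →
      (i : Fin nb) → EuclideanSpace ℝ (Fin (d i))}
    (hg : ∀ lam i, HasGradientAt (fun t => g (Function.update lam i t)) (g' lam i) (lam i))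
    (x z : (i : Fin nb) → EuclideanSpace ℝ (Fin (d i))) :
    ∑ i, ⟪g' x i, z i - x i⟫ ≤ g z - g x := by
  have hq : (nb : ℝ) ≠ 0 := by positivity
  have hder : HasDerivAt (fun t : ℝ => t * (g z - g x) + ∑ i, (nb : ℝ)⁻¹ *
      (g (Function.update x i (x i + t • (-(nb : ℝ) • (z i - x i)))) - g x))
      ((g z - g x) + ∑ i, (nb : ℝ)⁻¹ * ⟪g' x i, -(nb : ℝ) • (z i - x i)⟫) 0 := by
    refine HasDerivAt.add ?_ ?_
    · simpa using (hasDerivAt_id (0 : ℝ)).mul_const (g z - g x)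
    · refine HasDerivAt.fun_sum fun i _ => ?_
      have := aux_linederiv hg x i (-(nb : ℝ) • (z i - x i)) 0
      simp only [zero_smul, add_zero, Function.update_eq_self] at this
      exact (this.sub_const _).const_mul _
  have h := aux_deriv_nonneg hder (by simp) ?_
  · have : ∀ i, (nb : ℝ)⁻¹ * ⟪g' x i, -(nb : ℝ) • (z i - x i)⟫ = - ⟪g' x i, z i - x i⟫ := by
      intro i
      rw [inner_smul_right]
      field_simp
    simp only [this, Finset.sum_neg_distrib] at h
    linarith
  · intro t ht _
    have hJ := hgcv.map_sum_le (t := Finset.univ) (w := fun _ : Fin nb => (nb : ℝ)⁻¹)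
      (p := fun i => Function.update x i (x i + t • (-(nb : ℝ) • (z i - x i))))
      (fun _ _ => by positivity) (by simp [hq]) (fun _ _ => Set.mem_univ _)
    have e : ∑ i, (nb : ℝ)⁻¹ • Function.update x i (x i + t • (-(nb : ℝ) • (z i - x i)))
        = x - t • (z - x) := by
      have : ∀ i, Function.update x i (x i + t • (-(nb : ℝ) • (z i - x i)))
          = x + Pi.single i (t • (-(nb : ℝ) • (z i - x i))) := by
        intro i
        ext1 j
        by_cases hj : j = i
        · subst hj; simp
        · simp [hj]
      simp only [this, smul_add, Finset.sum_add_distrib, ← Finset.smul_sum]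
      rw [Finset.univ_sum_single (fun i => t • (-(nb : ℝ) • (z i - x i)))]
      ext1 j
      simp only [Finset.sum_const, Finset.card_univ, Fintype.card_fin, Pi.add_apply,
        Pi.smul_apply, Pi.sub_apply]
      rw [← Nat.cast_smul_eq_nsmul ℝ, smul_smul, inv_mul_cancel₀ hq, one_smul, smul_smul, smul_smul]
      have hc : (nb : ℝ)⁻¹ * t * -(nb : ℝ) = -t := by field_simp
      first
        | rw [hc]
        | rw [← mul_assoc, hc]
      rw [neg_smul, ← sub_eq_add_neg]
    rw [e] at hJ
    have hs1 : t / (1 + t) + 1 / (1 + t) = 1 := by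
      have h1 : (1 + t) ≠ 0 := by positivity
      rw [← add_div, add_comm t 1, div_self h1]
    have hc := hgcv.2 (Set.mem_univ z) (Set.mem_univ (x - t • (z - x)))
      (show 0 ≤ t / (1 + t) by positivity) (show 0 ≤ 1 / (1 + t) by positivity) hs1
    have e2 : (t / (1 + t)) • z + (1 / (1 + t)) • (x - t • (z - x)) = x := by
      have h1 : (1 + t) ≠ 0 := by positivity
      have : x = (t / (1 + t) - 1 / (1 + t) * t) • z + (1 / (1 + t) * (1 + t)) • x := by
        rw [one_div_mul_cancel h1]
        have : t / (1 + t) - 1 / (1 + t) * t = 0 := by ring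
        rw [this]; simp
      conv_rhs => rw [this]
      module
    rw [e2] at hc
    have hc2 : (1 + t) * g x ≤ t * g z + g (x - t • (z - x)) := by
      have h1 : 0 < 1 + t := by positivity
      have := mul_le_mul_of_nonneg_left hc h1.le
      simp only [smul_eq_mul] at this
      calc _ ≤ _ := this
        _ = _ := by field_simp
    simp only [smul_eq_mul] at hJ
    have e3 : ∑ i, (nb : ℝ)⁻¹ *
      (g (Function.update x i (x i + t • (-(nb : ℝ) • (z i - x i)))) - g x) =
      ∑ i, (nb : ℝ)⁻¹ *
      (g (Function.update x i (x i + t • (-(nb : ℝ) • (z i - x i))))) - g x := by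
      simp only [mul_sub, Finset.sum_sub_distrib]
      simp [hq]
    rw [e3]
    linarith

lemma aux_sum_succ {nb : ℕ} (π : Fin nb → ℝ) (k : ℕ) (F : (Fin k → Fin nb) → Fin nb → ℝ) :
    ∑ ω : Fin (k + 1) → Fin nb, (∏ i, π (ω i)) * F (fun i => ω i.castSucc) (ω (Fin.last k)) =
      ∑ ω : Fin k → Fin nb, (∏ i, π (ω i)) * ∑ i, π i * F ω i := by
  rw [← (Fin.snocEquiv (fun _ : Fin (k + 1) => Fin nb)).sum_comp, Fintype.sum_prod_type,
    Finset.sum_comm]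
  refine Finset.sum_congr rfl fun ω _ => ?_
  rw [Finset.mul_sum]
  refine Finset.sum_congr rfl fun i _ => ?_
  rw [Fin.prod_univ_castSucc]
  simp [Fin.snocEquiv]
  ring

theorem stmt13 {nb : ℕ} (hnb : 0 < nb) (d : Fin nb → ℕ)
    (Λ : (i : Fin nb) → Set (EuclideanSpace ℝ (Fin (d i))))
    (hΛcv : ∀ i, Convex ℝ (Λ i)) (hΛcp : ∀ i, IsCompact (Λ i)) (hΛne : ∀ i, (Λ i).Nonempty)
    (g : ((i : Fin nb) → EuclideanSpace ℝ (Fin (d i))) → ℝ)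
    (hgcv : ConvexOn ℝ Set.univ g)
    -- blockwise gradients of `g`
    (g' : ((i : Fin nb) → EuclideanSpace ℝ (Fin (d i))) →
      (i : Fin nb) → EuclideanSpace ℝ (Fin (d i)))
    (hg : ∀ lam i, HasGradientAt (fun t => g (Function.update lam i t)) (g' lam i) (lam i))
    -- block Lipschitz continuity of the gradient
    (Lip : Fin nb → ℝ) (hLippos : ∀ i, 0 < Lip i)
    (hlip : ∀ lam i t,
      ‖g' (Function.update lam i t) i - g' lam i‖ ≤ Lip i * ‖t - lam i‖)
    -- fixed block scalings `Sᵢ ⪯ Lᵢ⁻¹ I`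
    (S : (i : Fin nb) → Matrix (Fin (d i)) (Fin (d i)) ℝ)
    (hSpd : ∀ i, (S i).PosDef)
    (hSle : ∀ i, ((Lip i)⁻¹ • (1 : Matrix (Fin (d i)) (Fin (d i)) ℝ) - S i).PosSemidef)
    -- sampling probabilities
    (π : Fin nb → ℝ) (hπpos : ∀ i, 0 < π i) (hπsum : ∑ i, π i = 1)
    (πmin : ℝ) (hπmin : ∀ i, πmin ≤ π i) (hπminmem : ∃ i, π i = πmin)
    -- unique minimizer of `g` over the product set
    (lamstar : (i : Fin nb) → EuclideanSpace ℝ (Fin (d i)))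
    (hstar : ∀ i, lamstar i ∈ Λ i)
    (hminstar : IsMinOn g {lam | ∀ i, lam i ∈ Λ i} lamstar)
    (huniq : ∀ μ, (∀ i, μ i ∈ Λ i) → IsMinOn g {lam | ∀ i, lam i ∈ Λ i} μ → μ = lamstar)
    -- one unit-step scaled gradient-projection update of block `i`
    (newpt : ((i : Fin nb) → EuclideanSpace ℝ (Fin (d i))) →
      (i : Fin nb) → EuclideanSpace ℝ (Fin (d i)))
    (hnewmem : ∀ lam i, newpt lam i ∈ Λ i)
    (hnewmin : ∀ lam i, IsMinOn (fun t => ⟪g' lam i, t - lam i⟫ +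
        (1 / 2) * ⟪t - lam i, Matrix.toEuclideanLin (S i)⁻¹ (t - lam i)⟫)
      (Λ i) (newpt lam i))
    (step : ((i : Fin nb) → EuclideanSpace ℝ (Fin (d i))) → Fin nb →
      ((i : Fin nb) → EuclideanSpace ℝ (Fin (d i))))
    (hstep : ∀ lam i, step lam i = Function.update lam i (newpt lam i))
    -- the random trajectories, as a function of the sequence of drawn blocks
    (lam0 : (i : Fin nb) → EuclideanSpace ℝ (Fin (d i))) (hlam0 : ∀ i, lam0 i ∈ Λ i)
    (traj : (k : ℕ) → (Fin k → Fin nb) → ((i : Fin nb) → EuclideanSpace ℝ (Fin (d i))))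
    (htraj0 : ∀ ω, traj 0 ω = lam0)
    (htrajS : ∀ k (ω : Fin (k + 1) → Fin nb),
      traj (k + 1) ω = step (traj k (fun i => ω i.castSucc)) (ω (Fin.last k))) :
    -- expected sublinear decrease of the objective values
    let Psi : ((i : Fin nb) → EuclideanSpace ℝ (Fin (d i))) → ℝ := fun lam =>
      ((nb : ℝ) * πmin / 2) *
        (∑ i, ((nb : ℝ) * π i)⁻¹ *
          ⟪lam i - lamstar i, Matrix.toEuclideanLin (S i)⁻¹ (lam i - lamstar i)⟫) +
      g lam - g lamstar
    ∀ k : ℕ, (∑ ω : Fin k → Fin nb, (∏ i, π (ω i)) * (g (traj k ω) - g lamstar)) ≤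
      Psi lam0 / (1 + πmin * k) := by
  intro Psi
  have hπmin0 : 0 < πmin := by
    obtain ⟨i, hi⟩ := hπminmem
    rw [← hi]; exact hπpos i
  have hq : (0 : ℝ) < nb := by exact_mod_cast hnb
  have hm : ∀ x i, (∀ j, x j ∈ Λ j) → ⟪g' x i, newpt x i - x i⟫ + (1 / 2) *
      ⟪newpt x i - x i, Matrix.toEuclideanLin (S i)⁻¹ (newpt x i - x i)⟫ ≤ 0 := by
    intro x i hx
    have := hnewmin x i (hx i)
    simpa using this
  have hdesc : ∀ x i, g (step x i) - g x ≤ ⟪g' x i, newpt x i - x i⟫ + (1 / 2) *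
      ⟪newpt x i - x i, Matrix.toEuclideanLin (S i)⁻¹ (newpt x i - x i)⟫ := by
    intro x i
    rw [hstep]
    have h1 := aux_descent hg Lip hlip x i (newpt x i)
    have h2 := (aux_matrix (S i) (Lip i) (hLippos i) (hSpd i) (hSle i)).2 (newpt x i - x i)
    linarith
  have hstepmem : ∀ x i, (∀ j, x j ∈ Λ j) → ∀ j, step x i j ∈ Λ j := by
    intro x i hx j
    rw [hstep]
    by_cases hj : j = i
    · subst hj; simpa using hnewmem x j
    · simpa [hj] using hx j
  have htrajmem : ∀ k ω j, traj k ω j ∈ Λ j := by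
    intro k
    induction k with
    | zero => intro ω j; rw [htraj0]; exact hlam0 j
    | succ k ih => intro ω j; rw [htrajS]; exact hstepmem _ _ (ih _) j
  have hmono : ∀ x i, (∀ j, x j ∈ Λ j) → g (step x i) ≤ g x := by
    intro x i hx
    linarith [hm x i hx, hdesc x i]
  -- one step inequality
  have hone : ∀ x, (∀ j, x j ∈ Λ j) →
      ∑ i, π i * Psi (step x i) ≤ Psi x - πmin * (g x - g lamstar) := by
    intro x hx
    set Q : (i : Fin nb) → EuclideanSpace ℝ (Fin (d i)) → ℝ :=
      fun i v => ⟪v, Matrix.toEuclideanLin (S i)⁻¹ v⟫ with hQ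
    have hPsi : ∀ y, Psi y = (πmin / 2) * (∑ i, (π i)⁻¹ * Q i (y i - lamstar i)) +
        (g y - g lamstar) := by
      intro y
      simp only [Psi, hQ]
      rw [add_sub_assoc]
      congr 1
      rw [Finset.mul_sum, Finset.mul_sum]
      refine Finset.sum_congr rfl fun i _ => ?_
      have := (hπpos i).ne'
      field_simp
    have hR : ∀ i, π i * (∑ j, (π j)⁻¹ * Q j (step x i j - lamstar j)) =
        π i * (∑ j, (π j)⁻¹ * Q j (x j - lamstar j)) +
          (Q i (newpt x i - lamstar i) - Q i (x i - lamstar i)) := by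
      intro i
      rw [← Finset.add_sum_erase _ _ (Finset.mem_univ i),
        ← Finset.add_sum_erase Finset.univ (fun j => (π j)⁻¹ * Q j (x j - lamstar j))
          (Finset.mem_univ i)]
      have : ∑ j ∈ Finset.univ.erase i, (π j)⁻¹ * Q j (step x i j - lamstar j) =
          ∑ j ∈ Finset.univ.erase i, (π j)⁻¹ * Q j (x j - lamstar j) := by
        refine Finset.sum_congr rfl fun j hj => ?_
        rw [hstep, Function.update_of_ne (Finset.ne_of_mem_erase hj)]
      rw [this, hstep, Function.update_self]
      have := (hπpos i).ne'
      field_simp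
      ring
    have h3 : ∀ i, Q i (newpt x i - lamstar i) - Q i (x i - lamstar i) ≤
        2 * ⟪g' x i, lamstar i - x i⟫ + 2 * (g x - g (step x i)) := by
      intro i
      have h1 := aux_threepoint (Matrix.toEuclideanLin (S i)⁻¹)
        (aux_matrix (S i) (Lip i) (hLippos i) (hSpd i) (hSle i)).1 (hΛcv i)
        (x i) (newpt x i) (lamstar i) (g' x i) (hnewmem x i) (hstar i) (hnewmin x i)
      have h2 := hdesc x i
      simp only [hQ]
      linarith
    have h4 := aux_convex hnb hgcv hg x lamstar
    have h5 : ∀ i, πmin * (g x - g (step x i)) ≤ π i * (g x - g (step x i)) := fun i =>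
      mul_le_mul_of_nonneg_right (hπmin i) (by linarith [hmono x i hx])
    set R := ∑ j, (π j)⁻¹ * Q j (x j - lamstar j) with hRdef
    have h6 : ∀ i, π i * Psi (step x i) ≤ π i * Psi x + πmin * ⟪g' x i, lamstar i - x i⟫ := by
      intro i
      rw [hPsi, hPsi, ← hRdef]
      have ha := hR i
      have hb := mul_le_mul_of_nonneg_left (h3 i) hπmin0.le
      have hc := h5 i
      have hd : π i * (πmin / 2 * (∑ j, (π j)⁻¹ * Q j (step x i j - lamstar j)) +
          (g (step x i) - g lamstar)) = πmin / 2 * (π i *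
          (∑ j, (π j)⁻¹ * Q j (step x i j - lamstar j))) + π i * (g (step x i) - g lamstar) := by
        ring
      rw [hd, ha]
      linarith
    calc ∑ i, π i * Psi (step x i) ≤
        ∑ i, (π i * Psi x + πmin * ⟪g' x i, lamstar i - x i⟫) :=
          Finset.sum_le_sum fun i _ => h6 i
      _ = Psi x + πmin * ∑ i, ⟪g' x i, lamstar i - x i⟫ := by
          rw [Finset.sum_add_distrib, ← Finset.sum_mul, hπsum, one_mul, Finset.mul_sum]
      _ ≤ _ := by nlinarith
  -- expectations
  set e : ℕ → ℝ := fun k => ∑ ω : Fin k → Fin nb, (∏ i, π (ω i)) * (g (traj k ω) - g lamstar)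
    with he
  set P : ℕ → ℝ := fun k => ∑ ω : Fin k → Fin nb, (∏ i, π (ω i)) * Psi (traj k ω) with hP
  have hw : ∀ k (ω : Fin k → Fin nb), 0 ≤ ∏ i, π (ω i) := fun k ω =>
    Finset.prod_nonneg fun i _ => (hπpos _).le
  have hes : ∀ k, e (k + 1) ≤ e k := by
    intro k
    simp only [he, htrajS]
    rw [aux_sum_succ π k (fun ω i => g (step (traj k ω) i) - g lamstar)]
    refine Finset.sum_le_sum fun ω _ => mul_le_mul_of_nonneg_left ?_ (hw k ω)
    calc _ ≤ ∑ i, π i * (g (traj k ω) - g lamstar) := by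
          refine Finset.sum_le_sum fun i _ => mul_le_mul_of_nonneg_left ?_ (hπpos i).le
          linarith [hmono (traj k ω) i (htrajmem k ω)]
      _ = _ := by rw [← Finset.sum_mul, hπsum, one_mul]
  have hPs : ∀ k, P (k + 1) ≤ P k - πmin * e k := by
    intro k
    simp only [he, hP, htrajS]
    rw [aux_sum_succ π k (fun ω i => Psi (step (traj k ω) i)), Finset.mul_sum,
      ← Finset.sum_sub_distrib]
    refine Finset.sum_le_sum fun ω _ => ?_
    have := mul_le_mul_of_nonneg_left (hone (traj k ω) (htrajmem k ω)) (hw k ω)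
    linarith
  have heP : ∀ k, e k ≤ P k := by
    intro k
    refine Finset.sum_le_sum fun ω _ => mul_le_mul_of_nonneg_left ?_ (hw k ω)
    simp only [Psi]
    rw [add_sub_assoc]
    refine le_add_of_nonneg_left (mul_nonneg (by positivity) ?_)
    refine Finset.sum_nonneg fun i _ => mul_nonneg ?_ ?_
    · have := hπpos i
      positivity
    · refine le_trans ?_ ((aux_matrix (S i) (Lip i) (hLippos i) (hSpd i) (hSle i)).2 _)
      have := hLippos i
      positivity
  have hP0 : P 0 = Psi lam0 := by simp [hP, htraj0]
  have hind : ∀ k : ℕ, P k + πmin * k * e k ≤ Psi lam0 := by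
    intro k
    induction k with
    | zero => simp [hP0]
    | succ k ih =>
      have h1 := hPs k
      have h2 := mul_le_mul_of_nonneg_left (hes k)
        (show (0 : ℝ) ≤ πmin * (k + 1) by positivity)
      push_cast
      linarith
  intro k
  rw [le_div_iff₀ (by positivity)]
  have h1 := hind k
  have h2 := heP k
  change e k * _ ≤ _
  linarith
end

section
/- Let g be twice continuously differentiable near a stationary point x* of min_X g (X closed convex), S(·) a continuous scaling with S(x*) symmetric positive definite, σ ∈ (0,1), and suppose 2(1−σ) S(x*)⁻¹ ≻ ∇²g(x*). Then for any sequence xᵏ → x* generated by the scaled gradient projection with Armijo rule (step candidates β^m, m = 0,1,2,…), the selected step sizes satisfy α(xᵏ) = 1 for all sufficiently large k. -/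
open scoped RealInnerProductSpace
open Filter

/-- The Armijo sufficient-decrease test for the scaled gradient-projection step
`ynext x α` with step size `α`. -/
noncomputable def ArmijoOK {n : ℕ}
    (g : EuclideanSpace ℝ (Fin n) → ℝ)
    (S : EuclideanSpace ℝ (Fin n) → Matrix (Fin n) (Fin n) ℝ) (σ : ℝ)
    (ynext : EuclideanSpace ℝ (Fin n) → ℝ → EuclideanSpace ℝ (Fin n))
    (x : EuclideanSpace ℝ (Fin n)) (α : ℝ) : Prop :=
  g x - g (ynext x α) ≥
    σ * α⁻¹ * ⟪ynext x α - x, Matrix.toEuclideanLin (S x)⁻¹ (ynext x α - x)⟫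

lemma aux_coercive {n : ℕ} {T : Type*} [TopologicalSpace T]
    (C : T → (EuclideanSpace ℝ (Fin n) →L[ℝ] EuclideanSpace ℝ (Fin n))) (p : T)
    (hC : ContinuousAt C p) (hpos : ∀ v, v ≠ 0 → 0 < ⟪v, C p v⟫) :
    ∃ m > 0, ∀ᶠ q in nhds p, ∀ v, m * ‖v‖ ^ 2 ≤ ⟪v, C q v⟫ := by
  have h1 : ∃ m > 0, ∀ v, m * ‖v‖ ^ 2 ≤ ⟪v, C p v⟫ := by
    rcases (Metric.sphere (0 : EuclideanSpace ℝ (Fin n)) 1).eq_empty_or_nonempty with he | hne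
    · refine ⟨1, one_pos, fun v => ?_⟩
      by_cases hv : v = 0
      · simp [hv]
      · exfalso
        have : (‖v‖⁻¹ • v) ∈ Metric.sphere (0 : EuclideanSpace ℝ (Fin n)) 1 := by
          simp [norm_smul, hv]
        rw [he] at this
        exact this
    · have hcont : Continuous (fun v => ⟪v, C p v⟫) := by fun_prop
      obtain ⟨u, hu, hmin⟩ := (isCompact_sphere (0 : EuclideanSpace ℝ (Fin n)) 1).exists_isMinOn
        hne hcont.continuousOn
      have hu0 : u ≠ 0 := by
        rintro rfl
        simp at hu
      refine ⟨_, hpos u hu0, fun v => ?_⟩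
      by_cases hv : v = 0
      · simp [hv]
      · have hm : (‖v‖⁻¹ • v) ∈ Metric.sphere (0 : EuclideanSpace ℝ (Fin n)) 1 := by
          simp [norm_smul, hv]
        have h := hmin hm
        have hn : 0 < ‖v‖ := norm_pos_iff.mpr hv
        simp only [Set.mem_ofPred_eq, map_smul, real_inner_smul_left, real_inner_smul_right] at h
        calc _ ≤ (‖v‖⁻¹ * (‖v‖⁻¹ * ⟪v, C p v⟫)) * ‖v‖ ^ 2 := by gcongr
          _ = _ := by field_simp
  obtain ⟨m, hm, h⟩ := h1
  refine ⟨m / 2, by positivity, ?_⟩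
  filter_upwards [Metric.continuousAt_iff'.1 hC (m / 2) (by positivity)] with q hq v
  rw [dist_eq_norm] at hq
  have e : ⟪v, C q v⟫ = ⟪v, C p v⟫ + ⟪v, (C q - C p) v⟫ := by
    rw [← inner_add_right]; simp
  have h2 := abs_real_inner_le_norm v ((C q - C p) v)
  have h3 := (C q - C p).le_opNorm v
  have h4 : ‖v‖ * ‖(C q - C p) v‖ ≤ ‖v‖ * (m / 2 * ‖v‖) := by
    gcongr
    exact h3.trans (by gcongr)
  have h5 := h v
  have h6 := neg_abs_le ⟪v, (C q - C p) v⟫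
  nlinarith

lemma aux_lin (a b : ℝ) (h : ∀ t, 0 < t → t ≤ 1 → 0 ≤ t * a + t ^ 2 * b) : 0 ≤ a := by
  by_contra! ha
  have hd : 0 < |b| - a := by have := abs_nonneg b; linarith
  have h1 := h (-a / (|b| - a)) (div_pos (by linarith) hd)
    ((div_le_one hd).2 (by have := abs_nonneg b; linarith))
  have h2 : (-a / (|b| - a)) * a + (-a / (|b| - a)) ^ 2 * b
      = (-a / (|b| - a)) ^ 2 * (b - |b| + a) := by
    field_simp
    ring
  rw [h2] at h1
  have h3 : 0 < (-a / (|b| - a)) ^ 2 := by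
    have := div_pos (neg_pos.2 ha) hd
    positivity
  have h4 := le_abs_self b
  nlinarith

lemma aux_opt {n : ℕ} {X : Set (EuclideanSpace ℝ (Fin n))} (hX : Convex ℝ X)
    (A : EuclideanSpace ℝ (Fin n) →ₗ[ℝ] EuclideanSpace ℝ (Fin n))
    (hA : A.IsSymmetric) (c x y : EuclideanSpace ℝ (Fin n)) (hy : y ∈ X)
    (hmin : IsMinOn (fun y => ⟪c, y - x⟫ + (1 / (2 * (1 : ℝ))) * ⟪y - x, A (y - x)⟫) X y)
    (z : EuclideanSpace ℝ (Fin n)) (hz : z ∈ X) :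
    0 ≤ ⟪c, z - y⟫ + ⟪A (y - x), z - y⟫ := by
  apply aux_lin _ (1 / 2 * ⟪z - y, A (z - y)⟫)
  intro t ht0 ht1
  have hm : y + t • (z - y) ∈ X := hX.add_smul_sub_mem hy hz ⟨ht0.le, ht1⟩
  have h := hmin hm
  simp only [Set.mem_ofPred_eq] at h
  have e : y + t • (z - y) - x = (y - x) + t • (z - y) := by abel
  have hs : ⟪y - x, A (z - y)⟫ = ⟪A (y - x), z - y⟫ := (hA _ _).symm
  have hs2 : ⟪z - y, A (y - x)⟫ = ⟪A (y - x), z - y⟫ := real_inner_comm _ _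
  rw [e] at h
  simp only [map_add, map_smul, inner_add_left, inner_add_right, real_inner_smul_left,
    real_inner_smul_right, hs, hs2] at h
  linarith

lemma aux_taylor (f f1 f2 : ℝ → ℝ) (Q : ℝ)
    (h1 : ∀ t ∈ Set.Icc (0 : ℝ) 1, HasDerivAt f (f1 t) t)
    (h2 : ∀ t ∈ Set.Icc (0 : ℝ) 1, HasDerivAt f1 (f2 t) t)
    (h3 : ∀ t ∈ Set.Icc (0 : ℝ) 1, f2 t ≤ Q) : f 1 ≤ f 0 + f1 0 + Q / 2 := by
  have key : ∀ (φ φ' : ℝ → ℝ), (∀ t ∈ Set.Icc (0 : ℝ) 1, HasDerivAt φ (φ' t) t) →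
      (∀ t ∈ Set.Icc (0 : ℝ) 1, φ' t ≤ 0) → ∀ t ∈ Set.Icc (0 : ℝ) 1, φ t ≤ φ 0 := by
    intro φ φ' hd hn t ht
    have : AntitoneOn φ (Set.Icc 0 1) := by
      apply antitoneOn_of_deriv_nonpos (convex_Icc 0 1)
      · exact fun s hs => (hd s hs).continuousAt.continuousWithinAt
      · intro s hs
        exact (hd s (interior_subset hs)).differentiableAt.differentiableWithinAt
      · intro s hs
        rw [(hd s (interior_subset hs)).deriv]
        exact hn s (interior_subset hs)
    exact this ⟨le_rfl, zero_le_one⟩ ht ht.1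
  have a1 := key (fun t => f1 t - Q * t) (fun t => f2 t - Q * 1)
    (fun t ht => (h2 t ht).sub ((hasDerivAt_id t).const_mul Q))
    (fun t ht => by have := h3 t ht; linarith)
  have a2 := key (fun t => f t - f1 0 * t - Q / 2 * t ^ 2)
    (fun t => f1 t - f1 0 * 1 - Q / 2 * (2 * t))
    (fun t ht => by
      have := ((h1 t ht).sub ((hasDerivAt_id t).const_mul (f1 0))).sub
        ((hasDerivAt_pow 2 t).const_mul (Q / 2))
      refine this.congr_deriv ?_
      simp)
    (fun t ht => by have := a1 t ht; linarith) 1 ⟨zero_le_one, le_rfl⟩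
  linarith

lemma aux_pd {n : ℕ} {M : Matrix (Fin n) (Fin n) ℝ} (hM : M.PosDef)
    (v : EuclideanSpace ℝ (Fin n)) (hv : v ≠ 0) : 0 < ⟪v, Matrix.toEuclideanLin M v⟫ := by
  have h := hM.dotProduct_mulVec_pos (x := v.ofLp) (by simpa using hv)
  simpa [EuclideanSpace.inner_eq_star_dotProduct, Matrix.toEuclideanLin, dotProduct_comm] using h

lemma aux_cont {n : ℕ} : Continuous (fun M : Matrix (Fin n) (Fin n) ℝ =>
    (Matrix.toEuclideanLin M).toContinuousLinearMap) := by
  let L : Matrix (Fin n) (Fin n) ℝ →ₗ[ℝ]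
      (EuclideanSpace ℝ (Fin n) →L[ℝ] EuclideanSpace ℝ (Fin n)) :=
    (LinearMap.toContinuousLinearMap.toLinearMap) ∘ₗ (Matrix.toEuclideanLin.toLinearMap)
  exact L.continuous_of_finiteDimensional

set_option maxHeartbeats 4000000 in
theorem stmt17 {n : ℕ} (X : Set (EuclideanSpace ℝ (Fin n)))
    (hXne : X.Nonempty) (hXcl : IsClosed X) (hXcv : Convex ℝ X)
    (g : EuclideanSpace ℝ (Fin n) → ℝ) (hgcv : ConvexOn ℝ Set.univ g)
    (g' : EuclideanSpace ℝ (Fin n) → EuclideanSpace ℝ (Fin n))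
    (hg : ∀ x, HasGradientAt g (g' x) x)
    (xstar : EuclideanSpace ℝ (Fin n)) (hxstar : xstar ∈ X)
    (hstation : ∀ y ∈ X, ⟪g' xstar, y - xstar⟫ ≥ 0)
    -- `g` is twice continuously differentiable near `xstar`
    (Hess : EuclideanSpace ℝ (Fin n) → Matrix (Fin n) (Fin n) ℝ)
    (hHess : ∀ᶠ x in nhds xstar,
      HasFDerivAt g' ((Matrix.toEuclideanLin (Hess x)).toContinuousLinearMap) x)
    (hHesscont : ContinuousAt Hess xstar)
    -- continuous scaling, positive definite at `xstar`
    (S : EuclideanSpace ℝ (Fin n) → Matrix (Fin n) (Fin n) ℝ)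
    (hScont : ContinuousAt S xstar) (hSpd : ∀ x ∈ X, (S x).PosDef)
    (σ : ℝ) (hσ : σ ∈ Set.Ioo (0 : ℝ) 1)
    (hcond : ((2 * (1 - σ)) • (S xstar)⁻¹ - Hess xstar).PosDef)
    -- the gradient-projection map
    (ynext : EuclideanSpace ℝ (Fin n) → ℝ → EuclideanSpace ℝ (Fin n))
    (hynext : ∀ x α, 0 < α → ynext x α ∈ X ∧
      IsMinOn (fun y => ⟪g' x, y - x⟫ +
        (1 / (2 * α)) * ⟪y - x, Matrix.toEuclideanLin (S x)⁻¹ (y - x)⟫) X (ynext x α))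
    -- the generated sequence, with Armijo step sizes chosen among `{β^m}`
    (β : ℝ) (hβ : β ∈ Set.Ioo (0 : ℝ) 1)
    (x : ℕ → EuclideanSpace ℝ (Fin n)) (hxX : ∀ k, x k ∈ X)
    (alpha : ℕ → ℝ)
    (hgen : ∀ k, x (k + 1) = ynext (x k) (alpha k))
    (harmijo : ∀ k, ∃ mk : ℕ, alpha k = β ^ mk ∧
      ArmijoOK g S σ ynext (x k) (β ^ mk) ∧
      ∀ m' < mk, ¬ ArmijoOK g S σ ynext (x k) (β ^ m'))
    (hlim : Tendsto x atTop (nhds xstar)) :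
    ∀ᶠ k in atTop, alpha k = 1 := by
  obtain ⟨hσ0, hσ1⟩ := hσ
  obtain ⟨A, hA⟩ : ∃ A : EuclideanSpace ℝ (Fin n) → (EuclideanSpace ℝ (Fin n) →L[ℝ] EuclideanSpace ℝ (Fin n)),
    A = fun x => (Matrix.toEuclideanLin (S x)⁻¹).toContinuousLinearMap := ⟨_, rfl⟩
  obtain ⟨B, hB⟩ : ∃ B : EuclideanSpace ℝ (Fin n) → (EuclideanSpace ℝ (Fin n) →L[ℝ] EuclideanSpace ℝ (Fin n)),
    B = fun x => (Matrix.toEuclideanLin (Hess x)).toContinuousLinearMap := ⟨_, rfl⟩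
  have hAv : ∀ z v, A z v = Matrix.toEuclideanLin (S z)⁻¹ v := by
    intro z v; rw [hA]; rfl
  have hBv : ∀ z v, B z v = Matrix.toEuclideanLin (Hess z) v := by
    intro z v; rw [hB]; rfl
  have hHess' : ∀ᶠ x in nhds xstar, HasFDerivAt g' (B x) x := by
    rw [hB]; exact hHess
  clear hHess
  have hAc : ContinuousAt A xstar := by
    have hinv : ContinuousAt (fun x => (S x)⁻¹) xstar := by
      have hdet : IsUnit (S xstar).det := (hSpd xstar hxstar).det_pos.ne'.isUnit
      exact ContinuousAt.comp (g := Inv.inv) (continuousAt_matrix_inv (S xstar)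
        (NormedRing.inverse_continuousAt hdet.unit)) hScont
    rw [hA]
    exact aux_cont.continuousAt.comp hinv
  have hBc : ContinuousAt B xstar := by
    rw [hB]
    exact aux_cont.continuousAt.comp hHesscont
  clear hA hB
  have hApd : ∀ v, v ≠ 0 → 0 < ⟪v, A xstar v⟫ := fun v hv => by
    rw [hAv]; exact aux_pd (hSpd xstar hxstar).inv v hv
  obtain ⟨m, hm, hAm⟩ := aux_coercive A xstar hAc hApd
  obtain ⟨m2, hm2, hCm⟩ := aux_coercive
    (fun p : EuclideanSpace ℝ (Fin n) × EuclideanSpace ℝ (Fin n) =>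
      (2 * (1 - σ)) • A p.1 - B p.2) (xstar, xstar)
    (by
      have h1 : ContinuousAt (fun p : EuclideanSpace ℝ (Fin n) × EuclideanSpace ℝ (Fin n) =>
          A p.1) (xstar, xstar) := ContinuousAt.comp (g := A) hAc continuousAt_fst
      have h2 : ContinuousAt (fun p : EuclideanSpace ℝ (Fin n) × EuclideanSpace ℝ (Fin n) =>
          B p.2) (xstar, xstar) := ContinuousAt.comp (g := B) hBc continuousAt_snd
      exact (h1.const_smul (2 * (1 - σ))).sub h2)
    (by
      intro v hv
      have := aux_pd hcond v hv
      rw [map_sub, map_smul, LinearMap.sub_apply, LinearMap.smul_apply, ← hAv, ← hBv] at this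
      exact this)
  have hsymm : ∀ z ∈ X, (Matrix.toEuclideanLin (S z)⁻¹).IsSymmetric := fun z hz =>
    Matrix.isSymmetric_toEuclideanLin_iff.2 (hSpd z hz).inv.isHermitian
  obtain ⟨y, hy⟩ : ∃ y : ℕ → EuclideanSpace ℝ (Fin n), ∀ k, y k = ynext (x k) 1 :=
    ⟨_, fun _ => rfl⟩
  have hymin := fun k => hynext (x k) 1 one_pos
  simp only [← hy] at hymin
  have hyX : ∀ k, y k ∈ X := fun k => (hymin k).1
  have hopt : ∀ k, ∀ z ∈ X, 0 ≤ ⟪g' (x k), z - y k⟫ + ⟪A (x k) (y k - x k), z - y k⟫ :=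
    fun k z hz => by
     rw [hAv]
     exact aux_opt hXcv _ (hsymm _ (hxX k)) (g' (x k)) (x k) (y k) (hyX k)
      (hymin k).2 z hz
  have hg'c : ContinuousAt g' xstar := hHess'.self_of_nhds.continuousAt
  have hylim : Tendsto y atTop (nhds xstar) := by
    rw [tendsto_iff_norm_sub_tendsto_zero]
    have hr : Tendsto (fun k => m⁻¹ * ‖g' (x k) - g' xstar + A (x k) (xstar - x k)‖) atTop
        (nhds 0) := by
      have h1 : Tendsto (fun k => g' (x k)) atTop (nhds (g' xstar)) := hg'c.tendsto.comp hlim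
      have h2 : Tendsto (fun k => A (x k)) atTop (nhds (A xstar)) := hAc.tendsto.comp hlim
      have h3 : Tendsto (fun k => xstar - x k) atTop (nhds (xstar - xstar)) :=
        tendsto_const_nhds.sub hlim
      have h5 : Tendsto (fun k => A (x k) (xstar - x k)) atTop
          (nhds (A xstar (xstar - xstar))) :=
        (isBoundedBilinearMap_apply (𝕜 := ℝ) (E := EuclideanSpace ℝ (Fin n))
          (F := EuclideanSpace ℝ (Fin n))).continuous.continuousAt.tendsto.comp
          (h2.prodMk_nhds h3)
      have h4 := (((h1.sub_const (g' xstar)).add h5).norm).const_mul m⁻¹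
      simpa using h4
    refine squeeze_zero' (Eventually.of_forall fun k => norm_nonneg _) ?_ hr
    filter_upwards [hlim.eventually hAm] with k hk
    have h1 := hk (y k - xstar)
    have h2 := hopt k xstar hxstar
    have h3 := hstation (y k) (hyX k)
    obtain ⟨w, hw⟩ : ∃ w, w = y k - xstar := ⟨_, rfl⟩
    rw [← hw] at h1 h3 ⊢
    have e1 : xstar - y k = -w := by rw [hw]; abel
    have e2 : y k - x k = w + (xstar - x k) := by rw [hw]; abel
    rw [e1, e2, map_add, inner_add_left, inner_neg_right, inner_neg_right, inner_neg_right] at h2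
    have h4 : ⟪w, A (x k) w⟫ ≤ -⟪g' (x k) - g' xstar + A (x k) (xstar - x k), w⟫ := by
      rw [inner_add_left, inner_sub_left, real_inner_comm (A (x k) w) w]
      linarith
    have h5 := neg_le_of_abs_le (abs_real_inner_le_norm
      (g' (x k) - g' xstar + A (x k) (xstar - x k)) w)
    rw [inv_mul_eq_div, le_div_iff₀ hm]
    by_cases hw0 : w = 0
    · rw [hw0]; simp
    · have hwp : 0 < ‖w‖ := norm_pos_iff.2 hw0
      refine le_of_mul_le_mul_right ?_ hwp
      nlinarith
  -- neighbourhood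
  rw [nhds_prod_eq] at hCm
  obtain ⟨P1, hP1, P2, hP2, hP⟩ := eventually_prod_iff.1 hCm
  obtain ⟨ε, hε, hball⟩ := Metric.eventually_nhds_iff_ball.1 (hHess'.and hP2)
  have hxb := hlim.eventually (Metric.ball_mem_nhds xstar hε)
  have hyb := hylim.eventually (Metric.ball_mem_nhds xstar hε)
  filter_upwards [hxb, hyb, hlim.eventually hP1] with k hxk hyk hPk
  obtain ⟨mk, hmk, -, hno⟩ := harmijo k
  rcases Nat.eq_zero_or_pos mk with h0 | hpos
  · rw [hmk, h0, pow_zero]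
  exfalso
  apply hno 0 hpos
  rw [pow_zero]
  unfold ArmijoOK
  rw [← hy]
  rw [← hAv]
  change g (x k) - g (y k) ≥ σ * 1⁻¹ * ⟪y k - x k, A (x k) (y k - x k)⟫
  have hd := hopt k (x k) (hxX k)
  obtain ⟨d, hdd⟩ : ∃ d, d = y k - x k := ⟨_, rfl⟩
  rw [← hdd] at hd ⊢
  have hseg : ∀ t ∈ Set.Icc (0 : ℝ) 1, x k + t • d ∈ Metric.ball xstar ε := fun t ht => by
    rw [hdd]
    exact (convex_ball xstar ε).add_smul_sub_mem hxk hyk ht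
  have hline : ∀ t : ℝ, HasDerivAt (fun t : ℝ => x k + t • d) d t := fun t => by
    simpa using ((hasDerivAt_id t).smul_const d).const_add (x k)
  have hT := aux_taylor (fun t => g (x k + t • d)) (fun t => ⟪g' (x k + t • d), d⟫)
    (fun t => ⟪B (x k + t • d) d, d⟫) (2 * (1 - σ) * ⟪d, A (x k) d⟫)
    (fun t _ => by
      have := (hg (x k + t • d)).hasFDerivAt.comp_hasDerivAt t (hline t)
      refine this.congr_deriv ?_
      simp)
    (fun t ht => by
      have := ((hball _ (hseg t ht)).1.comp_hasDerivAt t (hline t)).inner ℝ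
        (hasDerivAt_const t d)
      refine this.congr_deriv ?_
      simp)
    (fun t ht => by
      have h1 := hP hPk (hball _ (hseg t ht)).2 d
      have h2 : 0 ≤ m2 * ‖d‖ ^ 2 := by positivity
      simp only [sub_apply, smul_apply, inner_sub_right,
        real_inner_smul_right] at h1
      rw [real_inner_comm]
      linarith)
  have e1 : x k - y k = -d := by rw [hdd]; abel
  have e2 : x k + d = y k := by rw [hdd]; abel
  rw [e1, inner_neg_right, inner_neg_right, real_inner_comm d (A (x k) d)] at hd
  simp only [one_smul, zero_smul, add_zero, e2] at hT
  rw [inv_one, mul_one]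
  first
    | linarith
    | (rw [real_inner_comm] at hd; linarith)
end
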